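/- Let P be a general program and M a set of atoms. Then GenDisj(P) ∪ {¬a : a ∈ σ_{GenDisj(P)} \ M} ⊩_I M if and only if P ∪ {¬a : a ∈ σ_P \ M} ⊩_I M. -/

import Mathlib

namespace ASP

/-- Propositional formulas over atoms `α`, built with ∧, ∨, ← and ⊥.
`impl A B` denotes the formula `B ← A` (i.e. `A → B`). -/
inductive PropForm (α : Type) : Type
  | var : α → PropForm α
  | fals : PropForm α
  | conj : PropForm α → PropForm α → PropForm α
  | disj : PropForm α → PropForm α → PropForm α
  | impl : PropForm α → PropForm α → PropForm α
  deriving DecidableEq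

namespace PropForm

variable {α : Type}

/-- `¬F` abbreviates `⊥ ← F`. -/
def neg (A : PropForm α) : PropForm α := impl A fals

/-- `⊤` abbreviates `⊥ ← ⊥`. -/
def top : PropForm α := impl fals fals

/-- The set of atoms occurring in a formula. -/
def atoms : PropForm α → Set α
  | var a => {a}
  | fals => ∅
  | conj A B => atoms A ∪ atoms B
  | disj A B => atoms A ∪ atoms B
  | impl A B => atoms A ∪ atoms B

end PropForm

open PropForm

/-- Hilbert-style derivability for intuitionistic propositional logic,
with an extra set `Ax` of additional axioms. -/
inductive Deriv {α : Type} (Ax : Set (PropForm α)) : PropForm α → Prop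
  | ax {A} : A ∈ Ax → Deriv Ax A
  | k (A B) : Deriv Ax (impl A (impl B A))
  | s (A B C) : Deriv Ax (impl (impl A (impl B C)) (impl (impl A B) (impl A C)))
  | conjIntro (A B) : Deriv Ax (impl A (impl B (conj A B)))
  | conjElimL (A B) : Deriv Ax (impl (conj A B) A)
  | conjElimR (A B) : Deriv Ax (impl (conj A B) B)
  | disjIntroL (A B) : Deriv Ax (impl A (disj A B))
  | disjIntroR (A B) : Deriv Ax (impl B (disj A B))
  | disjElim (A B C) : Deriv Ax (impl (impl A C) (impl (impl B C) (impl (disj A B) C)))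
  | falsElim (A) : Deriv Ax (impl fals A)
  | mp {A B} : Deriv Ax (impl A B) → Deriv Ax A → Deriv Ax B

/-- `F` is a theorem of intuitionistic propositional logic. -/
def IThm {α : Type} (F : PropForm α) : Prop := Deriv ∅ F

/-- `F` is a theorem of classical propositional logic
(intuitionistic logic plus double-negation elimination). -/
def CThm {α : Type} (F : PropForm α) : Prop :=
  Deriv {F | ∃ A, F = impl (neg (neg A)) A} F

/-- Conjunction of a finite list of formulas (empty conjunction is ⊤). -/
def bigConj {α : Type} : List (PropForm α) → PropForm α
  | [] => top
  | [A] => A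
  | A :: L => conj A (bigConj L)

/-- Disjunction of a finite list of formulas (empty disjunction is ⊥). -/
def bigDisj {α : Type} : List (PropForm α) → PropForm α
  | [] => fals
  | [A] => A
  | A :: L => disj A (bigDisj L)

/-- `T ⊢_X F`: the formula `F ← (F₁ ∧ ... ∧ Fₙ)` is a theorem of the logic
whose theorems are `Thm`, for some `F₁, ..., Fₙ ∈ T`. -/
def ProvesFrom {α : Type} (Thm : PropForm α → Prop) (T : Set (PropForm α))
    (F : PropForm α) : Prop :=
  ∃ L : List (PropForm α), (∀ G ∈ L, G ∈ T) ∧ Thm (impl (bigConj L) F)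

/-- `T ⊢_I F`. -/
def IProves {α : Type} (T : Set (PropForm α)) (F : PropForm α) : Prop :=
  ProvesFrom IThm T F

/-- `T ⊢_C F`. -/
def CProves {α : Type} (T : Set (PropForm α)) (F : PropForm α) : Prop :=
  ProvesFrom CThm T F

/-- `T` is consistent in intuitionistic logic. -/
def IConsistent {α : Type} (T : Set (PropForm α)) : Prop := ¬ IProves T fals

/-- `T ⊩_I M`: `T` is consistent and proves (intuitionistically) every atom of `M`. -/
def IProvesAll {α : Type} (T : Set (PropForm α)) (M : Set α) : Prop :=
  IConsistent T ∧ ∀ a ∈ M, IProves T (var a)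

/-- `T ≡_I U`: the two theories prove each other's formulas intuitionistically. -/
def IEquivTh {α : Type} (T U : Set (PropForm α)) : Prop :=
  (∀ F ∈ U, IProves T F) ∧ (∀ F ∈ T, IProves U F)

/-- The signature (set of occurring atoms) of a theory. -/
def sigTh {α : Type} (T : Set (PropForm α)) : Set α := ⋃ F ∈ T, F.atoms

/-- `T` is (literal) complete: for every atom `a` of its signature,
`T ⊢_I a` or `T ⊢_I ¬a`. -/
def IComplete {α : Type} (T : Set (PropForm α)) : Prop :=
  ∀ a ∈ sigTh T, IProves T (var a) ∨ IProves T (neg (var a))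

/-- `{¬a : a ∈ S}`. -/
def negSet {α : Type} (S : Set α) : Set (PropForm α) := (fun a => neg (var a)) '' S

/-- `{¬¬a : a ∈ S}`. -/
def negnegSet {α : Type} (S : Set α) : Set (PropForm α) :=
  (fun a => neg (neg (var a))) '' S

/-- Classical two-valued satisfaction, identifying an interpretation with the
set of atoms it makes true. -/
def sat2 {α : Type} (X : Set α) : PropForm α → Prop
  | .var a => a ∈ X
  | .fals => False
  | .conj A B => sat2 X A ∧ sat2 X B
  | .disj A B => sat2 X A ∨ sat2 X B
  | .impl A B => sat2 X A → sat2 X B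

/-- `X` is a classical model of the theory `T`. -/
def isModel2 {α : Type} (X : Set α) (T : Set (PropForm α)) : Prop := ∀ F ∈ T, sat2 X F

/-- `M` is a minimal (under ⊆) classical model of `T`. -/
def isMinModel {α : Type} (T : Set (PropForm α)) (M : Set α) : Prop :=
  isModel2 M T ∧ ∀ N ⊆ M, isModel2 N T → N = M

/-- Evaluation in the 3-valued Gödel logic G3. -/
def g3 {α : Type} (I : α → Fin 3) : PropForm α → Fin 3
  | .var a => I a
  | .fals => 0
  | .conj A B => min (g3 I A) (g3 I B)
  | .disj A B => max (g3 I A) (g3 I B)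
  | .impl A B => if g3 I A ≤ g3 I B then 2 else g3 I B

/-- Nested formulas: built from atoms, ⊤ and ⊥ using ∧, ∨ and ¬. -/
inductive NF (α : Type) : Type
  | var : α → NF α
  | top : NF α
  | bot : NF α
  | conj : NF α → NF α → NF α
  | disj : NF α → NF α → NF α
  | neg : NF α → NF α
  deriving DecidableEq

namespace NF

variable {α : Type}

/-- Reading a nested formula as a propositional formula
(`⊤ = ⊥ ← ⊥` and `¬F = ⊥ ← F`). -/
def toProp : NF α → PropForm α
  | var a => .var a
  | top => PropForm.top
  | bot => .fals
  | conj A B => .conj (toProp A) (toProp B)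
  | disj A B => .disj (toProp A) (toProp B)
  | neg A => PropForm.neg (toProp A)

/-- Atoms occurring in a nested formula. -/
def atoms : NF α → Set α
  | var a => {a}
  | top => ∅
  | bot => ∅
  | conj A B => atoms A ∪ atoms B
  | disj A B => atoms A ∪ atoms B
  | neg A => atoms A

/-- Satisfaction of a (basic, negation-free) nested formula by a set of atoms. -/
def satB (X : Set α) : NF α → Prop
  | var a => a ∈ X
  | top => True
  | bot => False
  | conj A B => satB X A ∧ satB X B
  | disj A B => satB X A ∨ satB X B
  | neg A => ¬ satB X A

open scoped Classical in
/-- The reduct `F^X`: each maximal subformula `¬G` is replaced by ⊥ if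
`X ⊨ G^X` and by ⊤ otherwise. -/
noncomputable def reduct (X : Set α) : NF α → NF α
  | var a => var a
  | top => top
  | bot => bot
  | conj A B => conj (reduct X A) (reduct X B)
  | disj A B => disj (reduct X A) (reduct X B)
  | neg A => if satB X (reduct X A) then bot else top

end NF

/-- An augmented clause `H ← B` is a pair `(H, B)` of nested formulas. -/
abbrev AugClause (α : Type) := NF α × NF α

/-- The propositional formula `H ← B` of an augmented clause. -/
def clauseToProp {α : Type} (c : AugClause α) : PropForm α :=
  .impl c.2.toProp c.1.toProp

/-- The theory of an augmented program. -/
def progTh {α : Type} (P : List (AugClause α)) : Set (PropForm α) :=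
  {F | ∃ c ∈ P, clauseToProp c = F}

/-- The signature of an augmented program. -/
def progSig {α : Type} (P : List (AugClause α)) : Set α :=
  {a | ∃ c ∈ P, a ∈ c.1.atoms ∪ c.2.atoms}

/-- `X` is closed under the (basic) program `P`: for each clause `H ← B`,
`X ⊨ H` whenever `X ⊨ B`. -/
def closedUnder {α : Type} (X : Set α) (P : List (AugClause α)) : Prop :=
  ∀ c ∈ P, NF.satB X c.2 → NF.satB X c.1

/-- The reduct `P^X` of an augmented program. -/
noncomputable def progReduct {α : Type} (X : Set α) (P : List (AugClause α)) :
    List (AugClause α) :=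
  P.map fun c => (c.1.reduct X, c.2.reduct X)

/-- `M` is an answer set of `P`: `M` is minimal (under ⊆) among the sets of
atoms closed under the reduct `P^M`. -/
def isAnswerSet {α : Type} (P : List (AugClause α)) (M : Set α) : Prop :=
  closedUnder M (progReduct M P) ∧ ∀ N ⊆ M, closedUnder N (progReduct M P) → N = M

/-- `M` is a min-answer set of `P`: both an answer set and a minimal model. -/
def isMinAnswerSet {α : Type} (P : List (AugClause α)) (M : Set α) : Prop :=
  isAnswerSet P M ∧ isMinModel (progTh P) M

/-- A G3 interpretation models an augmented program. -/
def g3ModelsProg {α : Type} (I : α → Fin 3) (P : List (AugClause α)) : Prop :=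
  ∀ c ∈ P, g3 I (clauseToProp c) = 2

/-- A free clause: a list of head literals and a list of body literals,
a literal being an atom `(a, true)` or a negated atom `(a, false)`.
It denotes `h₁ ∨ ... ∨ hₙ ← b₁ ∧ ... ∧ bₘ` (empty head = ⊥, empty body = ⊤). -/
structure FClause (α : Type) where
  head : List (α × Bool)
  body : List (α × Bool)
  deriving DecidableEq

/-- The propositional formula of a literal. -/
def litToProp {α : Type} : α × Bool → PropForm α
  | (a, true) => .var a
  | (a, false) => PropForm.neg (.var a)

/-- The nested formula of a literal. -/
def litToNF {α : Type} : α × Bool → NF α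
  | (a, true) => .var a
  | (a, false) => .neg (.var a)

/-- Disjunction of a list of nested formulas (empty = ⊥). -/
def bigDisjNF {α : Type} : List (NF α) → NF α
  | [] => .bot
  | [A] => A
  | A :: L => .disj A (bigDisjNF L)

/-- Conjunction of a list of nested formulas (empty = ⊤). -/
def bigConjNF {α : Type} : List (NF α) → NF α
  | [] => .top
  | [A] => A
  | A :: L => .conj A (bigConjNF L)

namespace FClause

variable {α : Type}

/-- The propositional formula of a free clause. -/
def toProp (c : FClause α) : PropForm α :=
  .impl (bigConj (c.body.map litToProp)) (bigDisj (c.head.map litToProp))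

/-- A free clause as an augmented clause. -/
def toAug (c : FClause α) : AugClause α :=
  (bigDisjNF (c.head.map litToNF), bigConjNF (c.body.map litToNF))

/-- The atoms of a free clause. -/
def atomsF (c : FClause α) : Set α :=
  {a | (∃ b, (a, b) ∈ c.head) ∨ (∃ b, (a, b) ∈ c.body)}

/-- A general clause: all head literals are positive atoms. -/
def isGeneral (c : FClause α) : Prop := ∀ l ∈ c.head, l.2 = true

/-- A disjunctive clause: a general clause with nonempty head. -/
def isDisjunctive (c : FClause α) : Prop := c.isGeneral ∧ c.head ≠ []

/-- A constraint: a clause with empty head (head ⊥). -/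
def isConstraint (c : FClause α) : Prop := c.head = []

end FClause

/-- The theory of a free program. -/
def fTh {α : Type} (P : List (FClause α)) : Set (PropForm α) :=
  {F | ∃ c ∈ P, c.toProp = F}

/-- The signature of a free program. -/
def fSig {α : Type} (P : List (FClause α)) : Set α :=
  {a | ∃ c ∈ P, a ∈ c.atomsF}

/-- `GenDisj(P)`: each constraint `⊥ ← B` is replaced by `p ← B ∧ ¬p`,
where `p` is a new reserved atom. -/
def genDisj {α : Type} [DecidableEq α] (P : List (FClause α)) (p : α) :
    List (FClause α) :=
  P.map fun c =>
    if c.head = [] then ⟨[(p, true)], c.body ++ [(p, false)]⟩ else c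

/-- The atoms `a` such that `¬a` occurs in the head of some clause of `P`
(the set `S` of the FreeGen transformation), as a list. -/
def headNegs {α : Type} (P : List (FClause α)) : List α :=
  P.flatMap fun c => c.head.filterMap fun l => if l.2 = false then some l.1 else none

open scoped Classical in
/-- Replace the occurrence of `¬a` (for `a ∈ S`) by the positive atom `φ a`. -/
noncomputable def substLit {α : Type} (S : Set α) (φ : α → α) (l : α × Bool) :
    α × Bool :=
  if l.2 = false ∧ l.1 ∈ S then (φ l.1, true) else l

/-- Replace every occurrence of `¬a` (for `a ∈ S`) by `φ a` in a clause. -/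
noncomputable def FClause.subst {α : Type} (S : Set α) (φ : α → α) (c : FClause α) :
    FClause α :=
  ⟨c.head.map (substLit S φ), c.body.map (substLit S φ)⟩

/-- `Δ_S = ⋃_{a ∈ S} {φ(a) ← ¬a, ⊥ ← a ∧ φ(a)}`. -/
def deltaClauses {α : Type} (L : List α) (φ : α → α) : List (FClause α) :=
  L.flatMap fun a => [⟨[(φ a, true)], [(a, false)]⟩, ⟨[], [(a, true), (φ a, true)]⟩]

/-- `FreeGen(P) = P' ∪ Δ_S`. -/
noncomputable def freeGen {α : Type} (P : List (FClause α)) (φ : α → α) :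
    List (FClause α) :=
  P.map (FClause.subst {a | a ∈ headNegs P} φ) ++ deltaClauses (headNegs P) φ

open scoped Classical in
/-- The second reduction `redu2(P; ¬¬M)`: clauses whose body contains a literal
`¬a` with `a ∈ M` are deleted; in constraints, positive body literals `a ∈ M`
are deleted. -/
noncomputable def redu2 {α : Type} [DecidableEq α] (P : List (FClause α))
    (M : Set α) : List (FClause α) :=
  (P.filter fun c => decide (¬ ∃ l ∈ c.body, l.2 = false ∧ l.1 ∈ M)).map
    fun c =>
      if c.head = [] then
        ⟨[], c.body.filter fun l => decide (¬ (l.2 = true ∧ l.1 ∈ M))⟩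
      else c

/-- `P₂` is a conservative extension of `P₁`: `M₁` is an answer set of `P₁`
iff `M₂` is an answer set of `P₂`, where `M₁ = M₂ ∩ σ_{P₁}`. -/
def consExt {α : Type} (P1 P2 : List (AugClause α)) : Prop :=
  (∀ M2 : Set α, isAnswerSet P2 M2 → isAnswerSet P1 (M2 ∩ progSig P1)) ∧
  (∀ M1 : Set α, isAnswerSet P1 M1 →
    ∃ M2 : Set α, isAnswerSet P2 M2 ∧ M1 = M2 ∩ progSig P1)

/-- `P₂` is a strong conservative extension of the user program `P₁` (relative
to the user signature `U`): for every user program `P`, `P₂ ∪ P` is a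
conservative extension of `P₁ ∪ P`. -/
def strongConsExt {α : Type} (P1 P2 : List (AugClause α)) (U : Set α) : Prop :=
  ∀ P : List (AugClause α), progSig P ⊆ U → consExt (P1 ++ P) (P2 ++ P)

mutual
  /-- Negation normal form: push negations inward (no pending negation). -/
  def nnf0 {α : Type} : NF α → NF α
    | .var a => .var a
    | .top => .top
    | .bot => .bot
    | .conj A B => .conj (nnf0 A) (nnf0 B)
    | .disj A B => .disj (nnf0 A) (nnf0 B)
    | .neg A => nnf1 A
  /-- Negation normal form under one pending negation. -/
  def nnf1 {α : Type} : NF α → NF α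
    | .var a => .neg (.var a)
    | .top => .bot
    | .bot => .top
    | .conj A B => .disj (nnf1 A) (nnf1 B)
    | .disj A B => .conj (nnf1 A) (nnf1 B)
    | .neg A => nnf2 A
  /-- Negation normal form under two pending negations. -/
  def nnf2 {α : Type} : NF α → NF α
    | .var a => .neg (.neg (.var a))
    | .top => .top
    | .bot => .bot
    | .conj A B => .conj (nnf2 A) (nnf2 B)
    | .disj A B => .disj (nnf2 A) (nnf2 B)
    | .neg A => nnf1 A
end

/-- Conjunctive normal form (list of disjunction-lists of leaves). -/
def cnfNF {α : Type} : NF α → List (List (NF α))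
  | .conj A B => cnfNF A ++ cnfNF B
  | .disj A B => (cnfNF A).flatMap fun c => (cnfNF B).map fun d => c ++ d
  | F => [[F]]

/-- Disjunctive normal form (list of conjunction-lists of leaves). -/
def dnfNF {α : Type} : NF α → List (List (NF α))
  | .disj A B => dnfNF A ++ dnfNF B
  | .conj A B => (dnfNF A).flatMap fun c => (dnfNF B).map fun d => c ++ d
  | F => [[F]]

/-- Read a leaf as a literal (if it is one). -/
def leafLit {α : Type} : NF α → Option (α × Bool)
  | .var a => some (a, true)
  | .neg (.var a) => some (a, false)
  | _ => none

/-- Read a leaf `¬¬a` as the literal `¬a` to be moved to the other side. -/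
def dnegLit {α : Type} : NF α → Option (α × Bool)
  | .neg (.neg (.var a)) => some (a, false)
  | _ => none

/-- Build a free clause from a head disjunct-list and a body conjunct-list:
doubly negated atoms `¬¬a` in the head become `¬a` in the body and vice versa;
trivial clauses (⊤ in the head or ⊥ in the body) are removed. -/
def procClause {α : Type} [DecidableEq α] (hd bd : List (NF α)) :
    Option (FClause α) :=
  if NF.top ∈ hd ∨ NF.bot ∈ bd then none
  else some ⟨hd.filterMap leafLit ++ bd.filterMap dnegLit,
             bd.filterMap leafLit ++ hd.filterMap dnegLit⟩

/-- `AugFree(P)`: the free program obtained from the augmented program `P` by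
pushing negations inward, taking CNF of heads and DNF of bodies, splitting
conjunctions in heads and disjunctions in bodies into separate clauses, and
eliminating doubly negated atoms. -/
def augFree {α : Type} [DecidableEq α] (P : List (AugClause α)) :
    List (FClause α) :=
  P.flatMap fun c =>
    (cnfNF (nnf0 c.1)).flatMap fun hd =>
      (dnfNF (nnf0 c.2)).filterMap fun bd => procClause hd bd

/-- Positive formulas: no negation (in particular no ⊥) occurs. -/
def IsPositive {α : Type} : PropForm α → Prop
  | .var _ => True
  | .fals => False
  | .conj A B => IsPositive A ∧ IsPositive B
  | .disj A B => IsPositive A ∧ IsPositive B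
  | .impl A B => IsPositive A ∧ IsPositive B

/-- The set 𝐍 of two-negated formulas. -/
inductive IsTwoNeg {α : Type} : PropForm α → Prop
  | atom (a : α) : IsTwoNeg (neg (neg (var a)))
  | dneg {A} : IsTwoNeg A → IsTwoNeg (neg (neg A))
  | conj {A B} : IsTwoNeg A → IsTwoNeg B → IsTwoNeg (PropForm.conj A B)
  | disjL {A} (B) : IsTwoNeg A → IsTwoNeg (PropForm.disj A B)
  | disjR {A} (B) : IsTwoNeg A → IsTwoNeg (PropForm.disj B A)
  | himp {A} (B) : IsTwoNeg A → IsTwoNeg (PropForm.impl B A)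

namespace Deriv

variable {α : Type} {T U : Set (PropForm α)} {A B C : PropForm α}

/-- Induction on derivations treating all logical axioms uniformly. -/
theorem logic_induction {motive : PropForm α → Prop} (hax : ∀ A ∈ T, motive A)
    (hlogic : ∀ A, (∀ V, Deriv V A) → motive A)
    (hmp : ∀ A B, motive (impl A B) → motive A → motive B) (d : Deriv T A) : motive A := by
  induction d with
  | ax hA => exact hax _ hA
  | k A B => exact hlogic _ fun _ => k A B
  | s A B C => exact hlogic _ fun _ => s A B C
  | conjIntro A B => exact hlogic _ fun _ => conjIntro A B
  | conjElimL A B => exact hlogic _ fun _ => conjElimL A B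
  | conjElimR A B => exact hlogic _ fun _ => conjElimR A B
  | disjIntroL A B => exact hlogic _ fun _ => disjIntroL A B
  | disjIntroR A B => exact hlogic _ fun _ => disjIntroR A B
  | disjElim A B C => exact hlogic _ fun _ => disjElim A B C
  | falsElim A => exact hlogic _ fun _ => falsElim A
  | mp _ _ ih₁ ih₂ => exact hmp _ _ ih₁ ih₂

theorem cut (h : ∀ B ∈ T, Deriv U B) (d : Deriv T A) : Deriv U A :=
  d.logic_induction h (fun _ hA => hA U) fun _ _ => mp

theorem mono (h : T ⊆ U) (d : Deriv T A) : Deriv U A :=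
  d.cut fun _ hB => ax (h hB)

theorem weaken (A : PropForm α) (d : Deriv T B) : Deriv T (impl A B) :=
  mp (k B A) d

/-- The deduction theorem. -/
theorem deduction (d : Deriv (insert A T) B) : Deriv T (impl A B) := by
  refine d.logic_induction (motive := fun B => Deriv T (impl A B)) ?_
    (fun _ hB => weaken _ (hB T)) fun _ _ h₁ h₂ => mp (mp (s _ _ _) h₁) h₂
  rintro B (rfl | hB)
  · exact mp (mp (s _ (impl B B) _) (k _ _)) (k _ _)
  · exact weaken _ (ax hB)

theorem assumption : Deriv (insert A T) A := ax (Set.mem_insert _ _)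

theorem insert_right (B : PropForm α) (d : Deriv T A) : Deriv (insert B T) A :=
  d.mono (Set.subset_insert _ _)

theorem conj_iff : Deriv T (conj A B) ↔ Deriv T A ∧ Deriv T B :=
  ⟨fun d => ⟨mp (conjElimL _ _) d, mp (conjElimR _ _) d⟩,
    fun d => mp (mp (conjIntro _ _) d.1) d.2⟩

theorem top : Deriv T (top : PropForm α) := falsElim _

theorem bigConj_iff : ∀ {L : List (PropForm α)},
    Deriv T (bigConj L) ↔ ∀ G ∈ L, Deriv T G
  | [] => by simpa [bigConj] using top
  | [A] => by simp [bigConj]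
  | A :: B :: L => by
    rw [bigConj, conj_iff, bigConj_iff, List.forall_mem_cons (a := A)]
    simp

theorem exists_list (d : Deriv T A) :
    ∃ L : List (PropForm α), (∀ G ∈ L, G ∈ T) ∧ Deriv {G | G ∈ L} A := by
  refine d.logic_induction
    (motive := fun A => ∃ L : List (PropForm α), (∀ G ∈ L, G ∈ T) ∧ Deriv {G | G ∈ L} A)
    (fun A hA => ⟨[A], by simpa using hA, ax (by simp)⟩)
    (fun A hA => ⟨[], by simp, hA _⟩) ?_
  rintro A B ⟨L₁, hL₁, d₁⟩ ⟨L₂, hL₂, d₂⟩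
  refine ⟨L₁ ++ L₂, ?_, mp (d₁.mono ?_) (d₂.mono ?_)⟩
  · intro G hG
    exact (List.mem_append.1 hG).elim (hL₁ G) (hL₂ G)
  · exact fun G hG => List.mem_append_left _ hG
  · exact fun G hG => List.mem_append_right _ hG

end Deriv

theorem iProves_iff_deriv {α : Type} {T : Set (PropForm α)} {F : PropForm α} :
    IProves T F ↔ Deriv T F := by
  constructor
  · rintro ⟨L, hL, d⟩
    exact (Deriv.mono (Set.empty_subset T) d).mp
      (Deriv.bigConj_iff.2 fun G hG => .ax (hL G hG))
  · intro d
    obtain ⟨L, hL, d⟩ := d.exists_list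
    exact ⟨L, hL, Deriv.deduction (d.cut (Deriv.bigConj_iff.1 Deriv.assumption))⟩

namespace PropForm

variable {α : Type} [DecidableEq α]

/-- Replace the atom `p` by `⊥`. -/
def falsify (p : α) : PropForm α → PropForm α
  | var a => if a = p then fals else var a
  | fals => fals
  | conj A B => conj (falsify p A) (falsify p B)
  | disj A B => disj (falsify p A) (falsify p B)
  | impl A B => impl (falsify p A) (falsify p B)

theorem falsify_of_notMem {p : α} {F : PropForm α} (h : p ∉ F.atoms) :
    falsify p F = F := by
  induction F with
  | var a => exact if_neg (Ne.symm h)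
  | fals => rfl
  | conj A B ihA ihB | disj A B ihA ihB | impl A B ihA ihB =>
    simp only [atoms, Set.mem_union, not_or] at h
    simp only [falsify, ihA h.1, ihB h.2]

theorem falsify_bigConj (p : α) : ∀ L : List (PropForm α),
    falsify p (bigConj L) = bigConj (L.map (falsify p))
  | [] => rfl
  | [A] => rfl
  | A :: B :: L => by
    have := falsify_bigConj p (B :: L)
    simp_all [bigConj, falsify]

end PropForm

theorem Deriv.falsify {α : Type} [DecidableEq α] (p : α) {T : Set (PropForm α)}
    {F : PropForm α} (d : Deriv T F) :
    Deriv (PropForm.falsify p '' T) (PropForm.falsify p F) := by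
  induction d with
  | ax hA => exact .ax ⟨_, hA, rfl⟩
  | mp _ _ ih₁ ih₂ => exact .mp ih₁ ih₂
  | k => exact .k _ _
  | s => exact .s _ _ _
  | conjIntro => exact .conjIntro _ _
  | conjElimL => exact .conjElimL _ _
  | conjElimR => exact .conjElimR _ _
  | disjIntroL => exact .disjIntroL _ _
  | disjIntroR => exact .disjIntroR _ _
  | disjElim => exact .disjElim _ _ _
  | falsElim => exact .falsElim _

/-- The truth function of implication in G3. -/
def g3Imp (x y : Fin 3) : Fin 3 := if x ≤ y then 2 else y

theorem g3_impl {α : Type} (I : α → Fin 3) (A B : PropForm α) :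
    g3 I (impl A B) = g3Imp (g3 I A) (g3 I B) := rfl

theorem g3_conj {α : Type} (I : α → Fin 3) (A B : PropForm α) :
    g3 I (conj A B) = min (g3 I A) (g3 I B) := rfl

theorem g3_disj {α : Type} (I : α → Fin 3) (A B : PropForm α) :
    g3 I (disj A B) = max (g3 I A) (g3 I B) := rfl

theorem Deriv.g3_eq_two {α : Type} {T : Set (PropForm α)} {I : α → Fin 3}
    (hT : ∀ F ∈ T, g3 I F = 2) {F : PropForm α} (d : Deriv T F) : g3 I F = 2 := by
  induction d with
  | ax hA => exact hT _ hA
  | @mp A B _ _ ih₁ ih₂ =>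
    rw [g3_impl] at ih₁
    generalize g3 I A = x at *
    generalize g3 I B = y at *
    decide +revert
  | falsElim A => simp [g3]
  | k A B | conjIntro A B | conjElimL A B | conjElimR A B
  | disjIntroL A B | disjIntroR A B =>
    simp only [g3_impl, g3_conj, g3_disj]
    generalize g3 I A = x
    generalize g3 I B = y
    decide +revert
  | s A B C | disjElim A B C =>
    simp only [g3_impl, g3_disj]
    generalize g3 I A = x
    generalize g3 I B = y
    generalize g3 I C = z
    decide +revert

open scoped Classical in
theorem g3_eq_ite_sat2 {α : Type} {I : α → Fin 3} {X : Set α} {F : PropForm α}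
    (h : ∀ a ∈ F.atoms, I a = if a ∈ X then 2 else 0) :
    g3 I F = if sat2 X F then 2 else 0 := by
  induction F with
  | var a => exact h a rfl
  | fals => simp [g3, sat2]
  | conj A B ihA ihB | disj A B ihA ihB | impl A B ihA ihB =>
    simp only [g3, sat2, ihA fun a ha => h a (Or.inl ha), ihB fun a ha => h a (Or.inr ha)]
    by_cases hA : sat2 X A <;> by_cases hB : sat2 X B <;> simp [hA, hB]

/-- A theory deciding all atoms of `F` decides `F`. -/
theorem Deriv.of_sat2 {α : Type} {T : Set (PropForm α)} {X : Set α} {F : PropForm α}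
    (hpos : ∀ a ∈ F.atoms, a ∈ X → Deriv T (var a))
    (hneg : ∀ a ∈ F.atoms, a ∉ X → Deriv T (neg (var a))) :
    (sat2 X F → Deriv T F) ∧ (¬ sat2 X F → Deriv T (neg F)) := by
  induction F with
  | var a => exact ⟨hpos a rfl, hneg a rfl⟩
  | fals => exact ⟨False.elim, fun _ => .falsElim _⟩
  | conj A B ihA ihB =>
    specialize ihA (fun a ha => hpos a (Or.inl ha)) (fun a ha => hneg a (Or.inl ha))
    specialize ihB (fun a ha => hpos a (Or.inr ha)) (fun a ha => hneg a (Or.inr ha))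
    refine ⟨fun h => conj_iff.2 ⟨ihA.1 h.1, ihB.1 h.2⟩, fun h => deduction ?_⟩
    by_cases hA : sat2 X A
    · exact ((ihB.2 fun hB => h ⟨hA, hB⟩).insert_right _).mp (conj_iff.1 assumption).2
    · exact ((ihA.2 hA).insert_right _).mp (conj_iff.1 assumption).1
  | disj A B ihA ihB =>
    specialize ihA (fun a ha => hpos a (Or.inl ha)) (fun a ha => hneg a (Or.inl ha))
    specialize ihB (fun a ha => hpos a (Or.inr ha)) (fun a ha => hneg a (Or.inr ha))
    refine ⟨fun h => h.elim (fun hA => (disjIntroL _ _).mp (ihA.1 hA))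
      (fun hB => (disjIntroR _ _).mp (ihB.1 hB)), fun h => ?_⟩
    exact ((disjElim _ _ _).mp (ihA.2 fun hA => h (Or.inl hA))).mp
      (ihB.2 fun hB => h (Or.inr hB))
  | impl A B ihA ihB =>
    specialize ihA (fun a ha => hpos a (Or.inl ha)) (fun a ha => hneg a (Or.inl ha))
    specialize ihB (fun a ha => hpos a (Or.inr ha)) (fun a ha => hneg a (Or.inr ha))
    constructor
    · intro h
      by_cases hA : sat2 X A
      · exact (ihB.1 (h hA)).weaken _
      · exact deduction ((falsElim _).mp (((ihA.2 hA).insert_right _).mp assumption))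
    · intro h
      have hAB : sat2 X A ∧ ¬ sat2 X B := Classical.not_imp.1 h
      exact deduction (((ihB.2 hAB.2).insert_right _).mp
        (assumption.mp ((ihA.1 hAB.1).insert_right _)))

section Programs

variable {α : Type}

theorem atoms_bigConj_subset : ∀ L : List (PropForm α),
    (bigConj L).atoms ⊆ {a | ∃ F ∈ L, a ∈ F.atoms}
  | [] => by simp [bigConj, PropForm.top, PropForm.atoms]
  | [A] => by simp [bigConj]
  | A :: B :: L => by
    intro a ha
    rcases ha with ha | ha
    · exact ⟨A, by simp, ha⟩
    · obtain ⟨F, hF, ha⟩ := atoms_bigConj_subset (B :: L) ha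
      exact ⟨F, List.mem_cons_of_mem _ hF, ha⟩

theorem atoms_bigDisj_subset : ∀ L : List (PropForm α),
    (bigDisj L).atoms ⊆ {a | ∃ F ∈ L, a ∈ F.atoms}
  | [] => by simp [bigDisj, PropForm.atoms]
  | [A] => by simp [bigDisj]
  | A :: B :: L => by
    intro a ha
    rcases ha with ha | ha
    · exact ⟨A, by simp, ha⟩
    · obtain ⟨F, hF, ha⟩ := atoms_bigDisj_subset (B :: L) ha
      exact ⟨F, List.mem_cons_of_mem _ hF, ha⟩

theorem atoms_litToProp : ∀ l : α × Bool, (litToProp l).atoms = {l.1}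
  | (a, true) => rfl
  | (a, false) => by simp [litToProp, neg, PropForm.atoms]

theorem FClause.atoms_toProp_subset (c : FClause α) : c.toProp.atoms ⊆ c.atomsF := by
  rintro a (ha | ha)
  · obtain ⟨F, hF, ha⟩ := atoms_bigConj_subset _ ha
    obtain ⟨⟨b, s⟩, hl, rfl⟩ := List.mem_map.1 hF
    rw [atoms_litToProp] at ha
    obtain rfl : a = b := ha
    exact Or.inr ⟨s, hl⟩
  · obtain ⟨F, hF, ha⟩ := atoms_bigDisj_subset _ ha
    obtain ⟨⟨b, s⟩, hl, rfl⟩ := List.mem_map.1 hF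
    rw [atoms_litToProp] at ha
    obtain rfl : a = b := ha
    exact Or.inl ⟨s, hl⟩

theorem toProp_mk_append (p : α) (B : List (α × Bool)) :
    (⟨[(p, true)], B ++ [(p, false)]⟩ : FClause α).toProp =
      impl (bigConj (B.map litToProp ++ [neg (var p)])) (var p) := by
  simp [FClause.toProp, bigDisj, litToProp]

theorem FClause.toProp_of_head_eq {c : FClause α} (h : c.head = []) :
    c.toProp = impl (bigConj (c.body.map litToProp)) fals := by
  simp [FClause.toProp, h, bigDisj]

variable [DecidableEq α] {P : List (FClause α)} {p : α} {M : Set α}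

theorem mem_genDisj_of_head_ne {c : FClause α} (hc : c ∈ P) (h : c.head ≠ []) :
    c ∈ genDisj P p :=
  List.mem_map.2 ⟨c, hc, if_neg h⟩

theorem mem_genDisj_of_head_eq {c : FClause α} (hc : c ∈ P) (h : c.head = []) :
    ⟨[(p, true)], c.body ++ [(p, false)]⟩ ∈ genDisj P p :=
  List.mem_map.2 ⟨c, hc, if_pos h⟩

theorem mem_genDisj {c : FClause α} (hc : c ∈ genDisj P p) :
    (c ∈ P ∧ c.head ≠ []) ∨
      ∃ d ∈ P, d.head = [] ∧ c = ⟨[(p, true)], d.body ++ [(p, false)]⟩ := by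
  obtain ⟨d, hd, rfl⟩ := List.mem_map.1 hc
  by_cases h : d.head = []
  · exact Or.inr ⟨d, hd, h, if_pos h⟩
  · simp only [if_neg h]
    exact Or.inl ⟨hd, h⟩

theorem fSig_subset_fSig_genDisj : fSig P ⊆ fSig (genDisj P p) := by
  rintro a ⟨c, hc, ha⟩
  by_cases h : c.head = []
  · refine ⟨_, mem_genDisj_of_head_eq hc h, ?_⟩
    rcases ha with ⟨b, hb⟩ | ⟨b, hb⟩
    · simp [h] at hb
    · exact Or.inr ⟨b, List.mem_append_left _ hb⟩
  · exact ⟨c, mem_genDisj_of_head_ne hc h, ha⟩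

theorem fSig_genDisj_subset : fSig (genDisj P p) ⊆ insert p (fSig P) := by
  rintro a ⟨c, hc, ha⟩
  rcases mem_genDisj hc with ⟨hc, -⟩ | ⟨d, hd, -, rfl⟩
  · exact Or.inr ⟨c, hc, ha⟩
  · rcases ha with ⟨b, hb⟩ | ⟨b, hb⟩
    · exact Or.inl (by simp_all)
    · rcases List.mem_append.1 hb with hb | hb
      · exact Or.inr ⟨d, hd, Or.inr ⟨b, hb⟩⟩
      · exact Or.inl (by simp_all)

theorem FClause.falsify_toProp (hp : p ∉ fSig P) {c : FClause α} (hc : c ∈ P) :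
    falsify p c.toProp = c.toProp :=
  falsify_of_notMem fun h => hp ⟨c, hc, c.atoms_toProp_subset h⟩

theorem falsify_neg_var {a : α} (h : a ≠ p) : falsify p (neg (var a)) = neg (var a) := by
  simp [neg, falsify, h]

theorem deriv_of_genDisj (hp : p ∉ fSig P) {F : PropForm α}
    (d : Deriv (fTh (genDisj P p) ∪ negSet (fSig (genDisj P p) \ M)) F) :
    Deriv (fTh P ∪ negSet (fSig P \ M)) (falsify p F) := by
  refine (d.falsify p).cut ?_
  rintro _ ⟨_, ⟨c, hc, rfl⟩ | ⟨a, ha, rfl⟩, rfl⟩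
  · rcases mem_genDisj hc with ⟨hc, -⟩ | ⟨c, hcP, h, rfl⟩
    · rw [FClause.falsify_toProp hp hc]
      exact .ax (Or.inl ⟨c, hc, rfl⟩)
    · have hf := FClause.falsify_toProp hp hcP
      rw [FClause.toProp_of_head_eq h] at hf
      simp only [falsify, impl.injEq, and_true] at hf
      rw [falsify_bigConj] at hf
      rw [toProp_mk_append]
      simp only [falsify, falsify_bigConj, if_pos]
      refine Deriv.deduction (Deriv.mp (A := bigConj (c.body.map litToProp)) ?_ ?_)
      · rw [← FClause.toProp_of_head_eq h]
        exact .insert_right _ (.ax (Or.inl ⟨c, hcP, rfl⟩))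
      · rw [← hf, Deriv.bigConj_iff]
        intro G hG
        refine Deriv.bigConj_iff.1 .assumption G ?_
        rw [List.map_append]
        exact List.mem_append_left _ hG
  · by_cases hap : a = p
    · subst hap
      simpa [neg, falsify] using Deriv.falsElim _
    · simp only [falsify_neg_var hap]
      exact .ax (Or.inr ⟨a, ⟨(fSig_genDisj_subset ha.1).resolve_left hap, ha.2⟩, rfl⟩)

theorem deriv_genDisj (hpM : p ∉ M) {F : PropForm α}
    (d : Deriv (fTh P ∪ negSet (fSig P \ M)) F) :
    Deriv (fTh (genDisj P p) ∪ negSet (fSig (genDisj P p) \ M)) F := by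
  refine d.cut ?_
  rintro _ (⟨c, hc, rfl⟩ | ⟨a, ha, rfl⟩)
  · by_cases h : c.head = []
    · have hc' := mem_genDisj_of_head_eq (p := p) hc h
      have hnp : Deriv (fTh (genDisj P p) ∪ negSet (fSig (genDisj P p) \ M)) (neg (var p)) :=
        .ax (Or.inr ⟨p, ⟨⟨_, hc', Or.inl ⟨true, by simp⟩⟩, hpM⟩, rfl⟩)
      rw [FClause.toProp_of_head_eq h]
      refine Deriv.deduction ((hnp.insert_right _).mp (Deriv.mp (.insert_right _
        (.ax (Or.inl ⟨_, hc', toProp_mk_append p c.body⟩))) ?_))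
      rw [Deriv.bigConj_iff]
      intro G hG
      rcases List.mem_append.1 hG with hG | hG
      · exact Deriv.bigConj_iff.1 .assumption G hG
      · rw [List.mem_singleton.1 hG]
        exact hnp.insert_right _
    · exact .ax (Or.inl ⟨c, mem_genDisj_of_head_ne hc h, rfl⟩)
  · exact .ax (Or.inr ⟨a, ⟨fSig_subset_fSig_genDisj ha.1, ha.2⟩, rfl⟩)

/-- In the transformed program the reserved atom is only derivable up to double negation. -/
theorem not_iProvesAll_genDisj (hp : p ∉ fSig P) (hpM : p ∈ M) :
    ¬ IProvesAll (fTh (genDisj P p) ∪ negSet (fSig (genDisj P p) \ M)) M := by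
  classical
  rintro ⟨hcons, hM⟩
  rw [IConsistent, iProves_iff_deriv] at hcons
  simp only [iProves_iff_deriv] at hM
  let I : α → Fin 3 := fun a => if a = p then 1 else if a ∈ M then 2 else 0
  suffices h : g3 I (var p) = 2 by simp [g3, I] at h
  refine (hM p hpM).g3_eq_two ?_
  rintro _ (⟨c, hc, rfl⟩ | ⟨a, ha, rfl⟩)
  · rcases mem_genDisj hc with ⟨hcP, -⟩ | ⟨d, -, -, rfl⟩
    · have hsat : sat2 M c.toProp := by
        by_contra hn
        refine hcons (((Deriv.of_sat2 (fun a _ => hM a) fun a ha haM => ?_).2 hn).mp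
          (.ax (Or.inl ⟨c, hc, rfl⟩)))
        exact .ax (Or.inr ⟨a, ⟨⟨c, hc, c.atoms_toProp_subset ha⟩, haM⟩, rfl⟩)
      rw [g3_eq_ite_sat2 (X := M), if_pos hsat]
      intro a ha
      refine if_neg ?_
      rintro rfl
      exact hp ⟨c, hcP, c.atoms_toProp_subset ha⟩
    · refine Deriv.g3_eq_two (T := {neg (neg (var p))}) (by simp [neg, g3, I]) ?_
      rw [toProp_mk_append]
      refine Deriv.deduction ((Deriv.falsElim _).mp (Deriv.mp (A := neg (var p))
        (.insert_right _ (.ax rfl)) (Deriv.bigConj_iff.1 .assumption _ (by simp))))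
  · have hap : a ≠ p := fun h => ha.2 (h ▸ hpM)
    simp [neg, g3, I, hap, ha.2]

theorem not_iProvesAll_of_notMem_fSig (hp : p ∉ fSig P) (hpM : p ∈ M) :
    ¬ IProvesAll (fTh P ∪ negSet (fSig P \ M)) M := by
  rintro ⟨hcons, hM⟩
  refine hcons (iProves_iff_deriv.2 ?_)
  have d := (iProves_iff_deriv.1 (hM p hpM)).falsify p
  simp only [falsify, if_pos] at d
  refine d.cut ?_
  rintro _ ⟨_, ⟨c, hc, rfl⟩ | ⟨a, ha, rfl⟩, rfl⟩
  · rw [FClause.falsify_toProp hp hc]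
    exact .ax (Or.inl ⟨c, hc, rfl⟩)
  · have hap : a ≠ p := fun h => ha.2 (h ▸ hpM)
    simp only [falsify_neg_var hap]
    exact .ax (Or.inr ⟨a, ha, rfl⟩)

end Programs

/-- for a general program `P`,
`GenDisj(P) ∪ {¬a : a ∈ σ_{GenDisj(P)} \ M} ⊩_I M` iff
`P ∪ {¬a : a ∈ σ_P \ M} ⊩_I M`. -/
theorem genDisj_proves_iff {α : Type} [DecidableEq α] (P : List (FClause α))
    (p : α) (hGen : ∀ c ∈ P, c.isGeneral) (hp : p ∉ fSig P) (M : Set α) :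
    IProvesAll (fTh (genDisj P p) ∪ negSet (fSig (genDisj P p) \ M)) M ↔
      IProvesAll (fTh P ∪ negSet (fSig P \ M)) M := by
  by_cases hpM : p ∈ M
  · exact iff_of_false (not_iProvesAll_genDisj hp hpM) (not_iProvesAll_of_notMem_fSig hp hpM)
  · simp only [IProvesAll, IConsistent, iProves_iff_deriv]
    refine and_congr (not_congr ⟨deriv_of_genDisj hp, deriv_genDisj hpM⟩)
      (forall₂_congr fun a ha => ⟨fun d => ?_, deriv_genDisj hpM⟩)
    have hap : a ≠ p := fun h => hpM (h ▸ ha)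
    simpa [falsify, hap] using deriv_of_genDisj hp d

end ASP
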